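/- arXiv:0708.3689 — 6 statements merged into one kernel-verified Lean document; each statement's English description precedes it below -/
import Mathlib

section
/- Fix an integer d ≥ 3 and nonzero integers a_1,...,a_d, and set D := 4d·max_i |a_i|. Let N be a prime, let k, ε be such that k^{ε} > 2D, let b_i, b_j ∈ Z_N, let a_u, a_v ∈ {a_1,...,a_d}, let m_2 > 2Dk^{3ε} be a positive integer, let m_1 be a positive integer, and set M := m_1 m_2. Suppose that either a_u b_i ≡ a_v b_j (mod N), or ‖ m_1 (a_u b_i − a_v b_j)/N ‖ > k^{4ε}/m_2. Then for all x, y ∈ Z_M satisfying ‖ x/M − b_i/N ‖ ≤ k^{3ε}/M and ‖ y/M − b_j/N ‖ ≤ k^{3ε}/M, the congruence a_u x ≡ a_v y (mod m_2) implies a_u x ≡ a_v y (mod M). -/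
/-- Distance from a real number to the nearest integer. -/
noncomputable def distNearestInt (x : ℝ) : ℝ := |x - round x|

theorem distNearestInt_le (x : ℝ) (n : ℤ) : distNearestInt x ≤ |x - n| :=
  round_le x n

theorem ZMod.exists_mul_val_sub_mul_val_eq {N : ℕ} [NeZero N] (a b : ℤ) (x y : ZMod N) :
    ∃ s : ℤ, a * (x.val : ℤ) - b * (y.val : ℤ) =
      (((a : ZMod N) * x - (b : ZMod N) * y).val : ℤ) + N * s := by
  obtain ⟨s, hs⟩ := (ZMod.intCast_eq_intCast_iff_dvd_sub
    ((((a : ZMod N) * x - (b : ZMod N) * y).val : ℤ))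
    (a * (x.val : ℤ) - b * (y.val : ℤ)) N).1 (by simp)
  exact ⟨s, by linarith⟩

/-- If `x / M` and `y / M` are close to `β` and `γ` modulo one and `m₂ ∣ a x - b y`, then, for some
integer `r`, the quotient `(a x - b y) / m₂` is close to `m₁ (a β - b γ + r)`. -/
theorem exists_abs_sub_mul_le {a b x y t : ℤ} {m₁ m₂ A L β γ : ℝ} (hm₁ : 0 < m₁) (hm₂ : 0 < m₂)
    (ha : |(a : ℝ)| ≤ A) (hb : |(b : ℝ)| ≤ A)
    (hx : distNearestInt (x / (m₁ * m₂) - β) ≤ L / (m₁ * m₂))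
    (hy : distNearestInt (y / (m₁ * m₂) - γ) ≤ L / (m₁ * m₂))
    (ht : (a * x - b * y : ℝ) = m₂ * t) :
    ∃ r : ℤ, |t - m₁ * (a * β - b * γ + r)| ≤ 2 * A * L / m₂ := by
  unfold distNearestInt at hx hy
  set p := round (x / (m₁ * m₂) - β)
  set q := round (y / (m₁ * m₂) - γ)
  refine ⟨a * p - b * q, ?_⟩
  have key : (t - m₁ * (a * β - b * γ + ((a * p - b * q : ℤ) : ℝ)) : ℝ) =
      m₁ * (a * (x / (m₁ * m₂) - β - p) - b * (y / (m₁ * m₂) - γ - q)) := by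
    have : (t : ℝ) = (a * x - b * y) / m₂ := by rw [ht]; field_simp
    rw [this]
    push_cast
    field_simp
    ring
  have hA : 0 ≤ A := (abs_nonneg _).trans ha
  rw [key, abs_mul, abs_of_pos hm₁]
  calc m₁ * |a * (x / (m₁ * m₂) - β - p) - b * (y / (m₁ * m₂) - γ - q)|
      ≤ m₁ * (A * (L / (m₁ * m₂)) + A * (L / (m₁ * m₂))) := by
        gcongr
        refine (abs_sub _ _).trans ?_
        rw [abs_mul, abs_mul]
        gcongr
    _ = 2 * A * L / m₂ := by field_simp; ring

theorem stmt_8 (d : ℕ) (hd : 3 ≤ d) (a : Fin d → ℤ) (ha : ∀ i, a i ≠ 0)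
    (D : ℕ) (hD : D = 4 * d * Finset.univ.sup (fun i => (a i).natAbs))
    (N : ℕ) [NeZero N] (hN : N.Prime)
    (k : ℕ) (ε : ℝ) (hkε : 2 * (D : ℝ) < (k : ℝ) ^ ε)
    (bi bj : ZMod N) (u v : Fin d)
    (m₁ m₂ : ℕ) (hm₁ : 0 < m₁) (hm₂ : 2 * (D : ℝ) * (k : ℝ) ^ (3 * ε) < (m₂ : ℝ))
    (M : ℕ) (hM : M = m₁ * m₂)
    (hsep : (a u : ZMod N) * bi = (a v : ZMod N) * bj ∨
      (k : ℝ) ^ (4 * ε) / (m₂ : ℝ) <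
        distNearestInt ((m₁ : ℝ) *
          ((((a u : ZMod N) * bi - (a v : ZMod N) * bj).val : ℕ) : ℝ) / (N : ℝ))) :
    ∀ x y : ZMod M,
      distNearestInt (((x.val : ℕ) : ℝ) / (M : ℝ) - ((bi.val : ℕ) : ℝ) / (N : ℝ)) ≤
        (k : ℝ) ^ (3 * ε) / (M : ℝ) →
      distNearestInt (((y.val : ℕ) : ℝ) / (M : ℝ) - ((bj.val : ℕ) : ℝ) / (N : ℝ)) ≤
        (k : ℝ) ^ (3 * ε) / (M : ℝ) →
      (m₂ : ℤ) ∣ (a u * (x.val : ℤ) - a v * (y.val : ℤ)) →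
      (a u : ZMod M) * x = (a v : ZMod M) * y := by
  intro x y hx hy ⟨t, ht⟩
  set A : ℕ := Finset.univ.sup (fun i => (a i).natAbs) with hA
  have hle (i : Fin d) : |(a i : ℝ)| ≤ A := by
    have : (a i).natAbs ≤ A := Finset.le_sup (f := fun i => (a i).natAbs) (Finset.mem_univ i)
    rw [← Int.cast_abs, Int.abs_eq_natAbs]
    exact_mod_cast this
  have hA1 : 1 ≤ (A : ℝ) := by
    refine le_trans ?_ (hle u)
    exact_mod_cast Int.one_le_abs (ha u)
  have hDA : 2 * (A : ℝ) ≤ D := by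
    have hd' : (3 : ℝ) ≤ d := by exact_mod_cast hd
    rw [hD]
    push_cast
    nlinarith
  have hpow (n : ℕ) : (k : ℝ) ^ (n * ε) = ((k : ℝ) ^ ε) ^ n := by
    rw [mul_comm, Real.rpow_mul_natCast (Nat.cast_nonneg k)]
  have h3 : (k : ℝ) ^ (3 * ε) = ((k : ℝ) ^ ε) ^ 3 := by exact_mod_cast hpow 3
  have h4 : (k : ℝ) ^ (4 * ε) = ((k : ℝ) ^ ε) ^ 4 := by exact_mod_cast hpow 4
  rw [h3] at hx hy hm₂
  rw [h4] at hsep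
  set K : ℝ := (k : ℝ) ^ ε
  have hK : 0 < K := by linarith
  have hK3 : 0 < K ^ 3 := by positivity
  have hm₂' : (0 : ℝ) < m₂ := lt_of_le_of_lt (by positivity) hm₂
  have hm₁' : (0 : ℝ) < m₁ := by exact_mod_cast hm₁
  have hM0 : NeZero M := ⟨by
    rw [hM]
    exact (Nat.mul_pos hm₁ (by exact_mod_cast hm₂')).ne'⟩
  have hMr : (M : ℝ) = m₁ * m₂ := by exact_mod_cast hM
  rw [hMr] at hx hy
  obtain ⟨r, hr⟩ := exists_abs_sub_mul_le (L := K ^ 3) (A := A)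
    (x := x.val) (y := y.val) (t := t)
    (β := bi.val / N) (γ := bj.val / N) hm₁' hm₂' (hle u) (hle v)
    (by rwa [Int.cast_natCast]) (by rwa [Int.cast_natCast]) (by exact_mod_cast ht)
  obtain ⟨s, hs⟩ := ZMod.exists_mul_val_sub_mul_val_eq (a u) (a v) bi bj
  set c := ((a u : ZMod N) * bi - (a v : ZMod N) * bj).val with hc
  have hN0 : (N : ℝ) ≠ 0 := by exact_mod_cast NeZero.ne N
  have hs' : (a u * (bi.val / N) - a v * (bj.val / N) : ℝ) = c / N + s := by
    have : (a u * bi.val - a v * bj.val : ℝ) = c + N * s := by exact_mod_cast hs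
    field_simp
    linarith
  rw [hs'] at hr
  rcases hsep with h | h
  · have hc0 : c = 0 := by rw [hc, h, sub_self, ZMod.val_zero]
    have hlt : 2 * A * K ^ 3 / m₂ < 1 := by
      rw [div_lt_one hm₂']
      nlinarith
    have hteq : t = m₁ * (s + r) := by
      have h1 : |((t - m₁ * (s + r) : ℤ) : ℝ)| < 1 := by
        refine lt_of_le_of_lt (le_of_eq_of_le ?_ hr) hlt
        rw [hc0]
        push_cast
        ring_nf
      rw [← sub_eq_zero, ← Int.abs_lt_one_iff]
      exact_mod_cast h1
    have hdvd : (M : ℤ) ∣ a u * (x.val : ℤ) - a v * (y.val : ℤ) :=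
      ⟨s + r, by rw [ht, hteq, hM]; push_cast; ring⟩
    simpa [sub_eq_zero] using (ZMod.intCast_zmod_eq_zero_iff_dvd _ M).2 hdvd
  · refine absurd (distNearestInt_le _ (t - m₁ * (s + r))) (not_le.2 (lt_of_le_of_lt ?_ h))
    calc _ = |(t : ℝ) - m₁ * (c / N + s + r)| := by
          rw [abs_sub_comm]
          push_cast
          ring_nf
      _ ≤ 2 * A * K ^ 3 / m₂ := hr
      _ ≤ K ^ 4 / m₂ := by
          gcongr
          nlinarith
end

section
/- Let M = m_1 m_2 with gcd(m_1, m_2) = 1, let V := {m_1 x : 0 ≤ x ≤ m_2 − 1} and W := {m_2 x : 0 ≤ x ≤ m_1 − 1} be the corresponding subgroups of Z_M, and for a ∈ Z_M write a = v(a) + w(a) with v(a) ∈ V, w(a) ∈ W (this decomposition is unique by the Chinese Remainder Theorem). Let a_1 be an integer with gcd(a_1, M) = 1, and let Y ⊆ Z_M be a set satisfying the correspondence property for a_1: for all x, y ∈ Y, a_1 x ≡ a_1 y (mod M) if and only if a_1 x ≡ a_1 y (mod m_2). Then the projection v is injective on Y; that is, for x, y ∈ Y, v(x) = v(y) implies x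 = y. -/
theorem stmt_9 (m₁ m₂ M : ℕ) (hM : M = m₁ * m₂) (hco : Nat.Coprime m₁ m₂)
    (v w : ZMod M → ZMod M)
    (hv : ∀ x : ZMod M, ∃ y : ZMod M, v x = (m₁ : ZMod M) * y)
    (hw : ∀ x : ZMod M, ∃ y : ZMod M, w x = (m₂ : ZMod M) * y)
    (hvw : ∀ x : ZMod M, x = v x + w x)
    (a₁ : ℤ) (ha₁ : IsCoprime a₁ (M : ℤ))
    (Y : Set (ZMod M))
    (hcorr : ∀ x ∈ Y, ∀ y ∈ Y,
      ((a₁ : ZMod M) * x = (a₁ : ZMod M) * y ↔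
        a₁ * (x.val : ℤ) ≡ a₁ * (y.val : ℤ) [ZMOD (m₂ : ℤ)])) :
    ∀ x ∈ Y, ∀ y ∈ Y, v x = v y → x = y := by
  intro x hx y hy hxy
  obtain ⟨s, hs⟩ := hw x
  obtain ⟨t, ht⟩ := hw y
  have hsub : x = y + (m₂ : ZMod M) * (s - t) := by
    rw [hvw x, hvw y, hxy, hs, ht]
    ring
  have hunit : IsUnit (a₁ : ZMod M) := by
    obtain ⟨b, c, hbc⟩ := ha₁
    refine IsUnit.of_mul_eq_one (b : ZMod M) ?_
    have h := congrArg (Int.cast : ℤ → ZMod M) hbc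
    push_cast at h
    rw [ZMod.natCast_self, mul_zero, add_zero] at h
    rw [mul_comm, h]
  have hcancel (h : a₁ * (x.val : ℤ) ≡ a₁ * (y.val : ℤ) [ZMOD (m₂ : ℤ)]) : x = y :=
    hunit.mul_left_cancel ((hcorr x hx y hy).2 h)
  rcases Nat.eq_zero_or_pos m₂ with h₂ | h₂
  · simpa [h₂] using hsub
  rcases Nat.eq_zero_or_pos m₁ with h₁ | h₁
  · have h₂' : m₂ = 1 := by simpa [h₁] using hco
    apply hcancel
    rw [h₂', Nat.cast_one]
    exact Int.modEq_one
  · have : NeZero M := ⟨by rw [hM]; positivity⟩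
    have hdvd : m₂ ∣ M := hM ▸ Dvd.intro_left m₁ rfl
    have hcast := congrArg (ZMod.castHom hdvd (ZMod m₂)) hsub
    rw [map_add, map_mul, map_natCast, ZMod.natCast_self, zero_mul, add_zero,
      ZMod.castHom_apply, ZMod.castHom_apply] at hcast
    apply hcancel
    apply Int.ModEq.mul_left
    rwa [← ZMod.intCast_eq_intCast_iff, Int.cast_natCast, Int.cast_natCast,
      ZMod.natCast_val, ZMod.natCast_val]
end

section
/- Let M = m_1 m_2 with gcd(m_1, m_2) = 1, let V, W be the subgroups of Z_M of multiples of m_1 and of m_2 respectively, and let v : Z_M → V be the Chinese-Remainder projection. Let a_1, ..., a_d be integers each coprime to M, and let Y ⊆ Z_M satisfy the correspondence property: for all x, y ∈ Y and all pairs i, j, a_i x ≡ a_j y (mod M) if and only if a_i x ≡ a_j y (mod m_2). Suppose x_1, ..., x_d ∈ Z_M and v_0 ∈ V are such that for each i, a_i x_i ∈ Y and v(a_i x_i) = a_i v_0 (in Z_M). Then x_1 = x_2 = ... = x_d in Z_M. -/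
theorem stmt_10 (m₁ m₂ M : ℕ) (hM : M = m₁ * m₂) (hco : Nat.Coprime m₁ m₂)
    (v w : ZMod M → ZMod M)
    (hv : ∀ x : ZMod M, ∃ y : ZMod M, v x = (m₁ : ZMod M) * y)
    (hw : ∀ x : ZMod M, ∃ y : ZMod M, w x = (m₂ : ZMod M) * y)
    (hvw : ∀ x : ZMod M, x = v x + w x)
    (d : ℕ) (a : Fin d → ℤ) (ha : ∀ i, IsCoprime (a i) (M : ℤ))
    (Y : Set (ZMod M))
    (hcorr : ∀ x ∈ Y, ∀ y ∈ Y, ∀ i j : Fin d,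
      ((a i : ZMod M) * x = (a j : ZMod M) * y ↔
        a i * (x.val : ℤ) ≡ a j * (y.val : ℤ) [ZMOD (m₂ : ℤ)]))
    (x : Fin d → ZMod M) (v₀ : ZMod M) (hv₀ : ∃ y : ZMod M, v₀ = (m₁ : ZMod M) * y)
    (hxY : ∀ i, (a i : ZMod M) * x i ∈ Y)
    (hproj : ∀ i, v ((a i : ZMod M) * x i) = (a i : ZMod M) * v₀) :
    ∀ i j, x i = x j := by
  have hunit : ∀ i, IsUnit ((a i : ZMod M)) := fun i => by
    obtain ⟨r, s, hrs⟩ := ha i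
    refine IsUnit.of_mul_eq_one (r : ZMod M) ?_
    have h := congrArg (Int.cast : ℤ → ZMod M) hrs
    push_cast at h
    simpa [mul_comm] using h
  rcases Nat.eq_zero_or_pos m₂ with h₂ | h₂
  · have hx : ∀ i, x i = v₀ := fun i => by
      obtain ⟨y, hy⟩ := hw ((a i : ZMod M) * x i)
      have h := hvw ((a i : ZMod M) * x i)
      rw [hproj i, hy, h₂, Nat.cast_zero, zero_mul, add_zero] at h
      exact (hunit i).mul_left_cancel h
    intro i j
    rw [hx i, hx j]
  intro i j
  suffices h : (a i : ZMod M) * ((a j : ZMod M) * x j) =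
      (a j : ZMod M) * ((a i : ZMod M) * x i) by
    rw [mul_left_comm] at h
    exact ((hunit i).mul_left_cancel ((hunit j).mul_left_cancel h)).symm
  refine (hcorr _ (hxY j) _ (hxY i) i j).2 ?_
  rcases Nat.eq_zero_or_pos m₁ with h₁ | h₁
  · have h : m₂ = 1 := by simpa [h₁] using hco
    rw [h, Nat.cast_one]
    exact Int.modEq_one
  have : NeZero M := ⟨by rw [hM]; positivity⟩
  let φ : ZMod M →+* ZMod m₂ := ZMod.castHom (hM ▸ dvd_mul_left m₂ m₁) (ZMod m₂)
  have hval : ∀ y : ZMod M, (y.val : ZMod m₂) = φ y := fun y => by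
    rw [← map_natCast φ, ZMod.natCast_zmod_val]
  have hφ : ∀ k, φ ((a k : ZMod M) * x k) = (a k : ZMod m₂) * φ v₀ := fun k => by
    obtain ⟨y, hy⟩ := hw ((a k : ZMod M) * x k)
    rw [hvw ((a k : ZMod M) * x k), hproj k, hy]
    simp only [map_add, map_mul, map_intCast, map_natCast, CharP.cast_eq_zero, zero_mul, add_zero]
  rw [← ZMod.intCast_eq_intCast_iff]
  simp only [Int.cast_mul, Int.cast_natCast, hval, hφ]
  ring
end

section
/- Let d ≥ 2 and let a_1, ..., a_d be nonzero integers with a_1 + ... + a_d = 0. Let N and M be positive integers with (|a_1| + ... + |a_d|) · N < M. Let f : Z_N → [0, ∞) and let g : Z_M → [0, ∞) be a function that vanishes outside the set of residues modulo M of integers n with −N/2 < n ≤ N/2, and such that for every integer n with −N/2 < n ≤ N/2, g(n mod M) ≤ f(n mod N). Then Σ over (x_1,...,x_d) ∈ Z_M^d with a_1 x_1 + ... + a_d x_d ≡ 0 (mod M) of g(x_1)···g(x_d) is at most Σ over (y_1,...,y_d) ∈ Z_N^d with a_1 y_1 + ... + a_d y_d ≡ 0 (mod N) of f(y_1)···f(y_d).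 -/
/-- An integer relation modulo `M` between small integers is an exact relation. -/
lemma sum_mul_eq_zero_of_zmod_of_abs_le {ι : Type*} [Fintype ι] (a n : ι → ℤ) {N M : ℕ}
    (hNM : (∑ i, |a i|) * (N : ℤ) < M) (hn : ∀ i, |n i| ≤ N)
    (h : ∑ i, (a i : ZMod M) * (n i : ZMod M) = 0) : ∑ i, a i * n i = 0 := by
  refine Int.eq_zero_of_abs_lt_dvd (m := M) ?_ ?_
  · rw [← ZMod.intCast_zmod_eq_zero_iff_dvd]
    simpa using h
  · calc |∑ i, a i * n i| ≤ ∑ i, |a i * n i| := Finset.abs_sum_le_sum_abs _ _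
      _ ≤ ∑ i, |a i| * (N : ℤ) := Finset.sum_le_sum fun i _ => by
          rw [abs_mul]
          exact mul_le_mul_of_nonneg_left (hn i) (abs_nonneg _)
      _ = (∑ i, |a i|) * (N : ℤ) := (Finset.sum_mul _ _ _).symm
      _ < M := hNM

/-- Lifting the least absolute residues modulo `N` to residues modulo `M ≥ N` is injective. -/
lemma ZMod.injective_intCast_valMinAbs {N M : ℕ} [NeZero N] [NeZero M] (hNM : N ≤ M) :
    Function.Injective fun y : ZMod N => (y.valMinAbs : ZMod M) := by
  have key (y : ZMod N) : (y.valMinAbs : ZMod M).valMinAbs = y.valMinAbs := by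
    have := y.valMinAbs_mem_Ioc
    rw [ZMod.valMinAbs_spec]
    refine ⟨rfl, ?_⟩
    simp only [Set.mem_Ioc] at this ⊢
    lia
  intro y z h
  apply ZMod.injective_valMinAbs
  rw [← key y, ← key z]
  exact congrArg ZMod.valMinAbs h


theorem stmt_11 (d : ℕ) (hd : 2 ≤ d) (a : Fin d → ℤ) (ha : ∀ i, a i ≠ 0)
    (hsum : ∑ i, a i = 0)
    (N M : ℕ) [NeZero N] [NeZero M]
    (hNM : ((∑ i, |a i| : ℤ) : ℝ) * (N : ℝ) < (M : ℝ))
    (f : ZMod N → ℝ) (hf : ∀ y, 0 ≤ f y)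
    (g : ZMod M → ℝ) (hg : ∀ x, 0 ≤ g x)
    (hsupp : ∀ x : ZMod M,
      (∀ n : ℤ, -(N : ℤ) < 2 * n → 2 * n ≤ (N : ℤ) → x ≠ (n : ZMod M)) → g x = 0)
    (hle : ∀ n : ℤ, -(N : ℤ) < 2 * n → 2 * n ≤ (N : ℤ) →
      g (n : ZMod M) ≤ f (n : ZMod N)) :
    (∑ x : Fin d → ZMod M,
        if (∑ i, (a i : ZMod M) * x i) = 0 then ∏ i, g (x i) else 0)
      ≤ (∑ y : Fin d → ZMod N,
        if (∑ i, (a i : ZMod N) * y i) = 0 then ∏ i, f (y i) else 0) := by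
  have hNM' : (∑ i, |a i|) * (N : ℤ) < M := by exact_mod_cast hNM
  have hle_NM : N ≤ M := by
    have h₁ : 1 ≤ ∑ i, |a i| :=
      (Int.one_le_abs (ha ⟨0, by lia⟩)).trans
        (Finset.single_le_sum (f := fun i => |a i|) (fun i _ => abs_nonneg _) (Finset.mem_univ _))
    have h₂ : (N : ℤ) ≤ (∑ i, |a i|) * (N : ℤ) := le_mul_of_one_le_left (by positivity) h₁
    lia
  let e : ZMod N → ZMod M := fun y => (y.valMinAbs : ZMod M)
  have he : Function.Injective e := ZMod.injective_intCast_valMinAbs hle_NM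
  have hbd (y : ZMod N) : -(N : ℤ) < 2 * y.valMinAbs ∧ 2 * y.valMinAbs ≤ N := by
    simpa [mul_comm] using y.valMinAbs_mem_Ioc
  have hge (y : ZMod N) : g (e y) ≤ f y := by
    simpa using hle y.valMinAbs (hbd y).1 (hbd y).2
  have hrange (x : ZMod M) (hx : x ∉ Set.range e) : g x = 0 := by
    refine hsupp x fun n h₁ h₂ hxn => hx ⟨(n : ZMod N), ?_⟩
    have hn : (n : ZMod N).valMinAbs = n :=
      (ZMod.valMinAbs_spec _ _).2 ⟨rfl, by lia, by lia⟩
    simp only [e, hn, hxn]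
  rw [← Fintype.sum_of_injective (fun y : Fin d → ZMod N => e ∘ y) he.comp_left
    (fun y => if (∑ i, (a i : ZMod M) * e (y i)) = 0 then ∏ i, g (e (y i)) else 0) _
    (fun x hx => ?_) (fun _ => rfl)]
  · refine Finset.sum_le_sum fun y _ => ?_
    have hprod : ∏ i, g (e (y i)) ≤ ∏ i, f (y i) :=
      Finset.prod_le_prod (fun i _ => hg _) fun i _ => hge _
    have hf_prod : 0 ≤ ∏ i, f (y i) := Finset.prod_nonneg fun i _ => hf _
    by_cases hM : ∑ i, (a i : ZMod M) * e (y i) = 0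
    · have hint := sum_mul_eq_zero_of_zmod_of_abs_le a (fun i => (y i).valMinAbs) hNM'
        (fun i => by have := hbd (y i); rw [abs_le]; lia) hM
      have hN : ∑ i, (a i : ZMod N) * y i = 0 := by
        simpa using congrArg (Int.cast : ℤ → ZMod N) hint
      rwa [if_pos hM, if_pos hN]
    · rw [if_neg hM]
      split_ifs
      exacts [hf_prod, le_rfl]
  · obtain ⟨i, hi⟩ : ∃ i, x i ∉ Set.range e := by
      by_contra! h
      choose y hy using h
      exact hx ⟨y, funext hy⟩
    rw [Finset.prod_eq_zero (Finset.mem_univ i) (hrange _ hi), ite_self]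
end

section
/- Let M = m_1 m_2 with gcd(m_1, m_2) = 1, let V := {m_1 x : 0 ≤ x ≤ m_2−1} and W := {m_2 x : 0 ≤ x ≤ m_1−1} be subgroups of Z_M, and for u ∈ Z_M define h_u := (1_{u+V} · g) * 1_W, where g : Z_M → ℂ and (F*G)(n) := Σ_{a+b ≡ n (mod M)} F(a)G(b). Then the Fourier transform of h_u satisfies: ĥ_u(a) = 0 for every a ∈ Z_M not in V, and for every a ∈ V, ĥ_u(a) = Σ_{x ∈ W} e^{−2πi x u / M} ĝ(a + x). -/
/-- The (unnormalized) Fourier transform of `F : ZMod M → ℂ`,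
`F̂(a) = ∑_{n} F(n) e^{2πi a n / M}`. -/
noncomputable def zmodFourierC {M : ℕ} [NeZero M] (F : ZMod M → ℂ) (a : ZMod M) : ℂ :=
  ∑ n : ZMod M, F n *
    Complex.exp (2 * Real.pi * Complex.I * ((a.val : ℂ) * (n.val : ℂ)) / (M : ℂ))

theorem zmodFourierC_eq_sum_stdAddChar {M : ℕ} [NeZero M] (F : ZMod M → ℂ) (a : ZMod M) :
    zmodFourierC F a = ∑ n : ZMod M, F n * ZMod.stdAddChar (a * n) := by
  refine Finset.sum_congr rfl fun n _ => ?_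
  have key : ((a.val * n.val : ℕ) : ℤ) = ((a * n : ZMod M)) := by
    push_cast
    simp
  rw [← key, ZMod.stdAddChar_coe]
  push_cast
  ring_nf

theorem exp_neg_eq_stdAddChar {M : ℕ} [NeZero M] (x u : ZMod M) :
    Complex.exp (-(2 * Real.pi * Complex.I) * ((x.val : ℂ) * (u.val : ℂ)) / (M : ℂ)) =
      ZMod.stdAddChar (x * -u) := by
  have key : ((-(x.val * u.val : ℕ) : ℤ) : ZMod M) = x * -u := by
    push_cast
    simp
  rw [← key, ZMod.stdAddChar_coe]
  push_cast
  ring_nf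

/-- The sum of the characters indexed by the subgroup `m₂ ℤ/Mℤ` is a multiple of the indicator
function of `m₁ ℤ/Mℤ`, when `M = m₁ * m₂`. -/
theorem sum_stdAddChar_multiples {m₁ m₂ M : ℕ} [NeZero M] (hM : M = m₁ * m₂) (t : ZMod M) :
    ∑ x ∈ Finset.image (fun s : ZMod M => (m₂ : ZMod M) * s) Finset.univ,
        (ZMod.stdAddChar (x * t) : ℂ) =
      if t ∈ Finset.image (fun s : ZMod M => (m₁ : ZMod M) * s) Finset.univ then
        ((Finset.image (fun s : ZMod M => (m₂ : ZMod M) * s) Finset.univ).card : ℂ) else 0 := by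
  have hM0 : (m₁ : ZMod M) * m₂ = 0 := by
    rw [← Nat.cast_mul, ← hM, ZMod.natCast_self]
  split_ifs with ht
  · obtain ⟨s, -, rfl⟩ := Finset.mem_image.1 ht
    rw [Finset.sum_congr rfl (g := fun _ => (1 : ℂ))]
    · simp
    · intro x hx
      obtain ⟨r, -, rfl⟩ := Finset.mem_image.1 hx
      have : (m₂ : ZMod M) * r * (m₁ * s) = 0 := by linear_combination r * s * hM0
      simp [this]
  · have hne : (ZMod.stdAddChar ((m₂ : ZMod M) * t) : ℂ) ≠ 1 := by
      intro h1
      have h0 : (m₂ : ZMod M) * t = 0 :=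
        ZMod.injective_stdAddChar (h1.trans (AddChar.map_zero_eq_one _).symm)
      apply ht
      have h2 : ((m₂ * t.val : ℕ) : ZMod M) = 0 := by simpa using h0
      rw [ZMod.natCast_eq_zero_iff] at h2
      replace h2 : m₂ * m₁ ∣ m₂ * t.val := by rwa [mul_comm m₂ m₁, ← hM]
      have hm₂ : 0 < m₂ := Nat.pos_of_ne_zero fun h => NeZero.ne M (by simp [hM, h])
      obtain ⟨c, hc⟩ := Nat.dvd_of_mul_dvd_mul_left hm₂ h2
      refine Finset.mem_image.2 ⟨c, Finset.mem_univ _, ?_⟩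
      rw [← ZMod.natCast_zmod_val t, hc, Nat.cast_mul]
    have hshift : ∑ x ∈ Finset.image (fun s : ZMod M => (m₂ : ZMod M) * s) Finset.univ,
        (ZMod.stdAddChar (x * t) : ℂ) = ZMod.stdAddChar ((m₂ : ZMod M) * t) *
        ∑ x ∈ Finset.image (fun s : ZMod M => (m₂ : ZMod M) * s) Finset.univ,
        (ZMod.stdAddChar (x * t) : ℂ) := by
      rw [Finset.mul_sum]
      symm
      refine Finset.sum_equiv (Equiv.addLeft (m₂ : ZMod M)) (fun x => ?_) fun x _ => ?_
      · simp only [Finset.mem_image, Finset.mem_univ, true_and, Equiv.coe_addLeft]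
        constructor
        · rintro ⟨s, rfl⟩
          exact ⟨1 + s, by ring⟩
        · rintro ⟨s, hs⟩
          exact ⟨s - 1, by linear_combination hs⟩
      · rw [Equiv.coe_addLeft, add_mul, AddChar.map_add_eq_mul]
    have h3 := sub_eq_zero.2 hshift
    rw [← one_sub_mul] at h3
    exact (mul_eq_zero.1 h3).resolve_left (sub_ne_zero.2 hne.symm)

/-- The Fourier transform of the convolution of `F` with the indicator function of `W`. -/
theorem zmodFourierC_conv_indicator {M : ℕ} [NeZero M] (F : ZMod M → ℂ) (W : Finset (ZMod M))
    (a : ZMod M) :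
    zmodFourierC (fun n => ∑ b : ZMod M, F (n - b) * (if b ∈ W then 1 else 0)) a =
      zmodFourierC F a * ∑ x ∈ W, ZMod.stdAddChar (x * a) := by
  simp only [zmodFourierC_eq_sum_stdAddChar, mul_ite, mul_one, mul_zero, Finset.sum_ite_mem,
    Finset.univ_inter, Finset.sum_mul]
  rw [Finset.sum_comm, ← Finset.sum_mul, Finset.mul_sum]
  refine Finset.sum_congr rfl fun b _ => ?_
  rw [Finset.sum_mul]
  refine Fintype.sum_equiv (Equiv.subRight b) _ _ fun n => ?_
  rw [Equiv.subRight_apply, mul_assoc, ← AddChar.map_add_eq_mul]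
  ring_nf


theorem stmt_12 (m₁ m₂ M : ℕ) [NeZero M] (hM : M = m₁ * m₂) (hco : Nat.Coprime m₁ m₂)
    (g : ZMod M → ℂ) (u : ZMod M)
    (V W : Finset (ZMod M))
    (hV : V = Finset.image (fun t : ZMod M => (m₁ : ZMod M) * t) Finset.univ)
    (hW : W = Finset.image (fun t : ZMod M => (m₂ : ZMod M) * t) Finset.univ)
    (h : ZMod M → ℂ)
    (hh : ∀ n : ZMod M, h n = ∑ b : ZMod M,
      (if n - b ∈ Finset.image (fun z => u + z) V then g (n - b) else 0) *
        (if b ∈ W then 1 else 0)) :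
    (∀ a : ZMod M, a ∉ V → zmodFourierC h a = 0) ∧
    (∀ a ∈ V, zmodFourierC h a =
      ∑ x ∈ W, Complex.exp (-(2 * Real.pi * Complex.I) *
          ((x.val : ℂ) * (u.val : ℂ)) / (M : ℂ)) * zmodFourierC g (a + x)) := by
  obtain rfl : h = _ := funext hh
  rw [hV, hW]
  refine ⟨fun a ha => ?_, fun a ha => ?_⟩
  · rw [zmodFourierC_conv_indicator (fun n => if n ∈ Finset.image _ _ then g n else 0),
      sum_stdAddChar_multiples hM, if_neg ha, mul_zero]
  · rw [zmodFourierC_conv_indicator (fun n => if n ∈ Finset.image _ _ then g n else 0),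
      sum_stdAddChar_multiples hM, if_pos ha]
    simp only [exp_neg_eq_stdAddChar, zmodFourierC_eq_sum_stdAddChar, Finset.mul_sum,
      Finset.sum_mul]
    rw [Finset.sum_comm]
    refine Finset.sum_congr rfl fun n _ => ?_
    have hmem : n ∈ Finset.image (fun z => u + z)
        (Finset.image (fun t : ZMod M => (m₁ : ZMod M) * t) Finset.univ) ↔
        n - u ∈ Finset.image (fun t : ZMod M => (m₁ : ZMod M) * t) Finset.univ := by
      rw [Finset.mem_image]
      constructor
      · rintro ⟨z, hz, rfl⟩
        simpa using hz
      · exact fun hz => ⟨_, hz, by ring⟩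
    have hsum := sum_stdAddChar_multiples hM (n - u)
    calc _ = g n * ZMod.stdAddChar (a * n) * (if n - u ∈ Finset.image
            (fun s : ZMod M => (m₁ : ZMod M) * s) Finset.univ then
            ((Finset.image (fun s : ZMod M => (m₂ : ZMod M) * s) Finset.univ).card : ℂ)
            else 0) := by
          simp only [hmem]
          split_ifs <;> simp
      _ = _ := by
          rw [← hsum, Finset.mul_sum]
          refine Finset.sum_congr rfl fun x _ => ?_
          rw [mul_left_comm, mul_assoc, ← AddChar.map_add_eq_mul, ← AddChar.map_add_eq_mul]
          ring_nf
end

section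
/- Let M = m_1 m_2 with gcd(m_1, m_2) = 1, and let W := {m_2 x : 0 ≤ x ≤ m_1 − 1} be the subgroup of Z_M of order m_1 consisting of multiples of m_2. Let d ≥ 2 and let a_1, ..., a_d be integers with a_1 + ... + a_d = 0 and gcd(a_d, M) = 1. Let h : Z_M → [0, ∞) be invariant under translation by W, i.e. h(n + w) = h(n) for all n ∈ Z_M and all w ∈ W. Then Σ over (x_1,...,x_d) ∈ Z_M^d with a_1 x_1 + ... + a_d x_d ≡ 0 (mod M) of h(x_1)···h(x_d) is at least m_1^{d−2} · Σ_{n ∈ Z_M} h(n)^d. -/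
/-- A sum of a nonnegative function dominates its sum along an injective map. -/
theorem sum_comp_le_sum_of_injective {α β : Type*} [Fintype α] [Fintype β]
    {f : α → β} (hf : Function.Injective f) (F : β → ℝ) (hF : ∀ b, 0 ≤ F b) :
    ∑ a, F (f a) ≤ ∑ b, F b := by
  classical
  rw [← Finset.sum_image (f := F) (s := Finset.univ) hf.injOn]
  exact Finset.sum_le_univ_sum_of_nonneg hF

/-- Multiples `m₂ * x` with `0 ≤ x < m₁` are distinct modulo `m₁ * m₂`. -/
theorem injective_natCast_mul_fin {m₁ m₂ M : ℕ} [NeZero M] (hM : M = m₁ * m₂) :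
    Function.Injective fun x : Fin m₁ => (m₂ : ZMod M) * ((x : ℕ) : ZMod M) := by
  have hm₂ : 0 < m₂ := Nat.pos_of_ne_zero fun h0 => NeZero.ne M (by simp [hM, h0])
  have hlt (x : Fin m₁) : m₂ * (x : ℕ) < M := by
    rw [hM, mul_comm m₁]
    exact Nat.mul_lt_mul_of_pos_left x.2 hm₂
  intro x y hxy
  simp only [← Nat.cast_mul] at hxy
  rw [ZMod.natCast_eq_natCast_iff', Nat.mod_eq_of_lt (hlt x), Nat.mod_eq_of_lt (hlt y)] at hxy
  exact Fin.ext (Nat.eq_of_mul_eq_mul_left hm₂ hxy)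

/-- A tuple `(n + c y₀, …, n + c yₖ)` with one more entry `n + c t`, where `t` is chosen so that
the tuple solves an invariant linear equation, solves that equation. -/
theorem sum_mul_snoc_eq_zero {R : Type*} [CommRing R] {k : ℕ} (a : Fin (k + 1) → R)
    (hsum : ∑ i, a i = 0) {u : R} (hu : a (Fin.last k) * u = 1) (n c : R) (y : Fin k → R) :
    ∑ i, a i * (Fin.snoc (fun i => n + c * y i)
      (n + c * (-u * ∑ i, a i.castSucc * y i)) : Fin (k + 1) → R) i = 0 := by
  rw [Fin.sum_univ_castSucc] at hsum ⊢
  simp only [Fin.snoc_castSucc, Fin.snoc_last, mul_add, Finset.sum_add_distrib,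
    mul_left_comm _ c, ← Finset.mul_sum, ← Finset.sum_mul]
  linear_combination n * hsum - c * (∑ i, a i.castSucc * y i) * hu

theorem stmt_15 (m₁ m₂ M : ℕ) [NeZero M] (hM : M = m₁ * m₂) (hco : Nat.Coprime m₁ m₂)
    (d : ℕ) (hd : 2 ≤ d) (a : Fin d → ℤ) (hsum : ∑ i, a i = 0)
    (had : IsCoprime (a ⟨d - 1, by omega⟩) (M : ℤ))
    (h : ZMod M → ℝ) (hpos : ∀ n, 0 ≤ h n)
    (hinv : ∀ n t : ZMod M, h (n + (m₂ : ZMod M) * t) = h n) :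
    (m₁ : ℝ) ^ (d - 2) * ∑ n : ZMod M, (h n) ^ d
      ≤ ∑ x : Fin d → ZMod M,
          if (∑ i, (a i : ZMod M) * x i) = 0 then ∏ i, h (x i) else 0 := by
  obtain ⟨k, rfl⟩ := Nat.exists_eq_add_of_le' hd
  obtain ⟨u, hu⟩ : ∃ u : ZMod M, (a (Fin.last (k + 1)) : ZMod M) * u = 1 := by
    obtain ⟨p, q, hpq⟩ := had
    refine ⟨p, ?_⟩
    have := congrArg (Int.cast : ℤ → ZMod M) hpq
    push_cast at this
    rw [ZMod.natCast_self, mul_zero, add_zero, mul_comm] at this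
    exact this
  have hsum' : ∑ i, (a i : ZMod M) = 0 := by exact_mod_cast congrArg (Int.cast : ℤ → ZMod M) hsum
  let y (v : Fin k → Fin m₁) : Fin (k + 1) → ZMod M := Fin.cons 0 fun i => ((v i : ℕ) : ZMod M)
  let f (p : ZMod M × (Fin k → Fin m₁)) : Fin (k + 2) → ZMod M :=
    Fin.snoc (fun i => p.1 + m₂ * y p.2 i)
      (p.1 + m₂ * (-u * ∑ i : Fin (k + 1), (a i.castSucc : ZMod M) * y p.2 i))
  have hf : Function.Injective f := by
    rintro ⟨n, v⟩ ⟨n', v'⟩ hp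
    have hinit (i : Fin (k + 1)) : n + m₂ * y v i = n' + m₂ * y v' i := by
      simpa [f] using congrFun hp i.castSucc
    obtain rfl : n = n' := by simpa [y] using hinit 0
    refine Prod.ext rfl (funext fun i => injective_natCast_mul_fin hM ?_)
    simpa [y] using hinit i.succ
  refine le_trans (le_of_eq ?_) (sum_comp_le_sum_of_injective hf _ fun x => ?_)
  · have hval (p : ZMod M × (Fin k → Fin m₁)) :
        (if (∑ i, (a i : ZMod M) * f p i) = 0 then ∏ i, h (f p i) else 0) = h p.1 ^ (k + 2) := by
      rw [if_pos (sum_mul_snoc_eq_zero (fun i => (a i : ZMod M)) hsum' hu p.1 m₂ (y p.2)),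
        Fin.prod_univ_castSucc]
      simp only [f, Fin.snoc_castSucc, Fin.snoc_last, hinv, Finset.prod_const, Finset.card_univ,
        Fintype.card_fin, pow_succ]
    simp only [hval, Fintype.sum_prod_type]
    simp [Finset.mul_sum]
  · split_ifs
    · exact Finset.prod_nonneg fun i _ => hpos _
    · exact le_rfl
end
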